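/- arXiv:2312.11329 — 4 statements merged into one kernel-verified Lean document; each statement's English description precedes it below -/
import Mathlib

section
/- For every z ∈ Z and every component i ∈ {1,…,n}, the kinky-inference confidence bounds are valid: w^min_D(z)_i ≤ f_i(z) ≤ w^max_D(z)_i. -/
/-- Kinky-inference upper confidence bound (componentwise):
`w^max_D(z)_i = min_{y ∈ D} (f_i(y) + q‖z − y‖^λ)`. -/
noncomputable def wmax {d n : ℕ} (f : EuclideanSpace ℝ (Fin d) → EuclideanSpace ℝ (Fin n))
    (q lam : ℝ) (D : Finset (EuclideanSpace ℝ (Fin d))) (hD : D.Nonempty)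
    (z : EuclideanSpace ℝ (Fin d)) (i : Fin n) : ℝ :=
  D.inf' hD fun y => f y i + q * ‖z - y‖ ^ lam

/-- Kinky-inference lower confidence bound (componentwise):
`w^min_D(z)_i = max_{y ∈ D} (f_i(y) − q‖z − y‖^λ)`. -/
noncomputable def wmin {d n : ℕ} (f : EuclideanSpace ℝ (Fin d) → EuclideanSpace ℝ (Fin n))
    (q lam : ℝ) (D : Finset (EuclideanSpace ℝ (Fin d))) (hD : D.Nonempty)
    (z : EuclideanSpace ℝ (Fin d)) (i : Fin n) : ℝ :=
  D.sup' hD fun y => f y i - q * ‖z - y‖ ^ lam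

/-- For every `z ∈ Z` and every component `i`, the kinky-inference
confidence bounds are valid: `w^min_D(z)_i ≤ f_i(z) ≤ w^max_D(z)_i`. -/
theorem kinky_bounds_valid (d n : ℕ) (Z : Set (EuclideanSpace ℝ (Fin d)))
    (f : EuclideanSpace ℝ (Fin d) → EuclideanSpace ℝ (Fin n)) (q lam : ℝ)
    (hq : 0 < q) (hlam0 : 0 < lam) (hlam1 : lam ≤ 1)
    (hf : ∀ z₁ ∈ Z, ∀ z₂ ∈ Z, ‖f z₁ - f z₂‖ ≤ q * ‖z₁ - z₂‖ ^ lam)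
    (D : Finset (EuclideanSpace ℝ (Fin d))) (hD : D.Nonempty) (hDZ : ↑D ⊆ Z) :
    ∀ z ∈ Z, ∀ i : Fin n,
      wmin f q lam D hD z i ≤ f z i ∧ f z i ≤ wmax f q lam D hD z i := by
  intro z hz i
  have key : ∀ y ∈ D, |f z i - f y i| ≤ q * ‖z - y‖ ^ lam := fun y hy => by
    simpa using (PiLp.norm_apply_le (f z - f y) i).trans (hf z hz y (hDZ hy))
  constructor
  · refine Finset.sup'_le hD _ fun y hy => ?_
    linarith [(abs_le.mp (key y hy)).1]
  · refine Finset.le_inf' hD _ fun y hy => ?_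
    linarith [(abs_le.mp (key y hy)).2]
end

section
/- For every z ∈ ℝ^d and every component i ∈ {1,…,n}, one has w^min_D(z)_i ≤ w^max_D(z)_i; that is, the lower confidence bound never exceeds the upper confidence bound, even at points outside Z. -/
/-- For every `z ∈ ℝ^d` and every component `i`,
`w^min_D(z)_i ≤ w^max_D(z)_i`, even at points outside `Z`. -/
theorem kinky_min_le_max (d n : ℕ) (Z : Set (EuclideanSpace ℝ (Fin d)))
    (f : EuclideanSpace ℝ (Fin d) → EuclideanSpace ℝ (Fin n)) (q lam : ℝ)
    (hq : 0 < q) (hlam0 : 0 < lam) (hlam1 : lam ≤ 1)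
    (hf : ∀ z₁ ∈ Z, ∀ z₂ ∈ Z, ‖f z₁ - f z₂‖ ≤ q * ‖z₁ - z₂‖ ^ lam)
    (D : Finset (EuclideanSpace ℝ (Fin d))) (hD : D.Nonempty) (hDZ : ↑D ⊆ Z) :
    ∀ z : EuclideanSpace ℝ (Fin d), ∀ i : Fin n,
      wmin f q lam D hD z i ≤ wmax f q lam D hD z i := by
  intro z i
  refine Finset.sup'_le _ _ fun x hx => Finset.le_inf' _ _ fun y hy => ?_
  have hcoord : f x i - f y i ≤ ‖f x - f y‖ :=
    (le_abs_self _).trans (PiLp.norm_apply_le (f x - f y) i)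
  have htri : ‖x - y‖ ≤ ‖z - x‖ + ‖z - y‖ := by
    simpa [norm_sub_rev x z] using norm_sub_le_norm_sub_add_norm_sub x z y
  have hpow : ‖x - y‖ ^ lam ≤ ‖z - x‖ ^ lam + ‖z - y‖ ^ lam :=
    (Real.rpow_le_rpow (norm_nonneg _) htri hlam0.le).trans
      (Real.rpow_add_le_add_rpow (norm_nonneg _) (norm_nonneg _) hlam0.le hlam1)
  have hmul := mul_le_mul_of_nonneg_left hpow hq.le
  linarith [hf x (hDZ hx) y (hDZ hy)]
end

section
/- The midpoint nominal model f_D := (w^max_D + w^min_D)/2 satisfies w^min_D(z)_i ≤ f_D(z)_i ≤ w^max_D(z)_i for all z ∈ ℝ^d and all i, and each component of f_D is (q, λ)-Hölder continuous on ℝ^d: |f_D(z)_i − f_D(y)_i| ≤ q‖z − y‖^λ for all z, y ∈ ℝ^d. -/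
/-- The midpoint nominal model `f_D := (w^max_D + w^min_D)/2` (componentwise). -/
noncomputable def fmid {d n : ℕ} (f : EuclideanSpace ℝ (Fin d) → EuclideanSpace ℝ (Fin n))
    (q lam : ℝ) (D : Finset (EuclideanSpace ℝ (Fin d))) (hD : D.Nonempty)
    (z : EuclideanSpace ℝ (Fin d)) (i : Fin n) : ℝ :=
  (wmax f q lam D hD z i + wmin f q lam D hD z i) / 2

lemma norm_sub_rpow_le_add {E : Type*} [SeminormedAddCommGroup E] {p : ℝ} (hp0 : 0 ≤ p)
    (hp1 : p ≤ 1) (x y z : E) : ‖x - z‖ ^ p ≤ ‖x - y‖ ^ p + ‖y - z‖ ^ p :=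
  (Real.rpow_le_rpow (norm_nonneg _) (norm_sub_le_norm_sub_add_norm_sub x y z) hp0).trans
    (Real.rpow_add_le_add_rpow (norm_nonneg _) (norm_nonneg _) hp0 hp1)

lemma wmin_le_wmax {d n : ℕ} {f : EuclideanSpace ℝ (Fin d) → EuclideanSpace ℝ (Fin n)}
    {q lam : ℝ} (hq : 0 ≤ q) (hlam0 : 0 ≤ lam) (hlam1 : lam ≤ 1)
    {D : Finset (EuclideanSpace ℝ (Fin d))} (hD : D.Nonempty)
    (hf : ∀ x ∈ D, ∀ y ∈ D, ‖f x - f y‖ ≤ q * ‖x - y‖ ^ lam)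
    (z : EuclideanSpace ℝ (Fin d)) (i : Fin n) :
    wmin f q lam D hD z i ≤ wmax f q lam D hD z i := by
  refine Finset.sup'_le hD _ fun x hx => Finset.le_inf' hD _ fun y hy => ?_
  have hcoord : f x i - f y i ≤ ‖f x - f y‖ :=
    (le_abs_self _).trans (PiLp.norm_apply_le (f x - f y) i)
  have htri := mul_le_mul_of_nonneg_left (norm_sub_rpow_le_add hlam0 hlam1 x z y) hq
  rw [norm_sub_rev x z, mul_add] at htri
  linarith [hf x hx y hy]

lemma wmax_le_wmax_add {d n : ℕ} (f : EuclideanSpace ℝ (Fin d) → EuclideanSpace ℝ (Fin n))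
    {q lam : ℝ} (hq : 0 ≤ q) (hlam0 : 0 ≤ lam) (hlam1 : lam ≤ 1)
    {D : Finset (EuclideanSpace ℝ (Fin d))} (hD : D.Nonempty)
    (z y : EuclideanSpace ℝ (Fin d)) (i : Fin n) :
    wmax f q lam D hD z i ≤ wmax f q lam D hD y i + q * ‖z - y‖ ^ lam := by
  rw [← sub_le_iff_le_add]
  refine Finset.le_inf' hD _ fun x hx => ?_
  have hle : wmax f q lam D hD z i ≤ f x i + q * ‖z - x‖ ^ lam := Finset.inf'_le _ hx
  have htri := mul_le_mul_of_nonneg_left (norm_sub_rpow_le_add hlam0 hlam1 z y x) hq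
  linarith

lemma wmin_le_wmin_add {d n : ℕ} (f : EuclideanSpace ℝ (Fin d) → EuclideanSpace ℝ (Fin n))
    {q lam : ℝ} (hq : 0 ≤ q) (hlam0 : 0 ≤ lam) (hlam1 : lam ≤ 1)
    {D : Finset (EuclideanSpace ℝ (Fin d))} (hD : D.Nonempty)
    (z y : EuclideanSpace ℝ (Fin d)) (i : Fin n) :
    wmin f q lam D hD z i ≤ wmin f q lam D hD y i + q * ‖z - y‖ ^ lam := by
  refine Finset.sup'_le hD _ fun x hx => ?_
  have hle : f x i - q * ‖y - x‖ ^ lam ≤ wmin f q lam D hD y i :=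
    Finset.le_sup' (fun x => f x i - q * ‖y - x‖ ^ lam) hx
  have htri := mul_le_mul_of_nonneg_left (norm_sub_rpow_le_add hlam0 hlam1 y z x) hq
  rw [norm_sub_rev y z, mul_add] at htri
  linarith

lemma fmid_sub_le {d n : ℕ} (f : EuclideanSpace ℝ (Fin d) → EuclideanSpace ℝ (Fin n))
    {q lam : ℝ} (hq : 0 ≤ q) (hlam0 : 0 ≤ lam) (hlam1 : lam ≤ 1)
    {D : Finset (EuclideanSpace ℝ (Fin d))} (hD : D.Nonempty)
    (z y : EuclideanSpace ℝ (Fin d)) (i : Fin n) :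
    fmid f q lam D hD z i - fmid f q lam D hD y i ≤ q * ‖z - y‖ ^ lam := by
  unfold fmid
  linarith [wmax_le_wmax_add f hq hlam0 hlam1 hD z y i,
    wmin_le_wmin_add f hq hlam0 hlam1 hD z y i]

/-- The midpoint nominal model satisfies
`w^min_D(z)_i ≤ f_D(z)_i ≤ w^max_D(z)_i` for all `z ∈ ℝ^d` and all `i`, and each
component of `f_D` is `(q, λ)`-Hölder continuous on `ℝ^d`. -/
theorem kinky_midpoint_model (d n : ℕ) (Z : Set (EuclideanSpace ℝ (Fin d)))
    (f : EuclideanSpace ℝ (Fin d) → EuclideanSpace ℝ (Fin n)) (q lam : ℝ)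
    (hq : 0 < q) (hlam0 : 0 < lam) (hlam1 : lam ≤ 1)
    (hf : ∀ z₁ ∈ Z, ∀ z₂ ∈ Z, ‖f z₁ - f z₂‖ ≤ q * ‖z₁ - z₂‖ ^ lam)
    (D : Finset (EuclideanSpace ℝ (Fin d))) (hD : D.Nonempty) (hDZ : ↑D ⊆ Z) :
    (∀ z : EuclideanSpace ℝ (Fin d), ∀ i : Fin n,
      wmin f q lam D hD z i ≤ fmid f q lam D hD z i ∧
      fmid f q lam D hD z i ≤ wmax f q lam D hD z i) ∧
    (∀ z y : EuclideanSpace ℝ (Fin d), ∀ i : Fin n,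
      |fmid f q lam D hD z i - fmid f q lam D hD y i| ≤ q * ‖z - y‖ ^ lam) := by
  constructor
  · intro z i
    have hle := wmin_le_wmax hq.le hlam0.le hlam1 hD
      (fun x hx y hy => hf x (hDZ hx) y (hDZ hy)) z i
    unfold fmid
    constructor <;> linarith
  · intro z y i
    refine abs_sub_le_iff.mpr ⟨fmid_sub_le f hq.le hlam0.le hlam1 hD z y i, ?_⟩
    rw [norm_sub_rev]
    exact fmid_sub_le f hq.le hlam0.le hlam1 hD y z i
end

section
/- Let Z ⊆ ℝ^d be a compact convex set with nonempty interior and let δ be a class K∞ function that is continuous. Then there exists a class K∞ function δ₂ (depending only on Z and δ) such that for every function g : Z → [0, ∞) satisfying |g(z) − g(y)| ≤ δ(‖z − y‖) for all z, y ∈ Z, and for every z̄ ∈ Z, one has g(z̄) ≤ δ₂(∫_Z g(z) dz), where the integral is with respect to Lebesgue measure. -/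
/-- A class `K∞` function: strictly increasing on `[0, ∞)`, vanishing at `0`, mapping
`[0, ∞)` into `[0, ∞)`, and tending to `∞` at `∞`. -/
def IsKInf (α : ℝ → ℝ) : Prop :=
  StrictMonoOn α (Set.Ici 0) ∧ α 0 = 0 ∧ (∀ t, 0 ≤ t → 0 ≤ α t) ∧
    Filter.Tendsto α Filter.atTop Filter.atTop

open MeasureTheory Filter Topology in
/-- A function on a convex compact set with monotone modulus of continuity `δ` is bounded at a
point by the modulus at scale `t` plus its average over the copy of the set shrunk towards that
point by the factor `t`. -/
theorem le_modulus_add_integral_div {d : ℕ} {Z : Set (EuclideanSpace ℝ (Fin d))}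
    (hZc : IsCompact Z) (hZconv : Convex ℝ Z) (hV : 0 < volume.real Z)
    {δ : ℝ → ℝ} (hmono : MonotoneOn δ (Set.Ici 0)) (h0 : δ 0 = 0) (hδcont : Continuous δ)
    {R : ℝ} (hR : ∀ z ∈ Z, ∀ y ∈ Z, ‖z - y‖ ≤ R)
    {g : EuclideanSpace ℝ (Fin d) → ℝ} (hg : ∀ z ∈ Z, 0 ≤ g z)
    (hgδ : ∀ z ∈ Z, ∀ y ∈ Z, |g z - g y| ≤ δ ‖z - y‖)
    {x : EuclideanSpace ℝ (Fin d)} (hx : x ∈ Z) {t : ℝ} (ht0 : 0 < t) (ht1 : t ≤ 1) :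
    g x ≤ δ (t * R) + (∫ z in Z, g z) / (volume.real Z * t ^ d) := by
  have hcont : ContinuousOn g Z := by
    intro z hz
    have hlim : Tendsto (fun y => δ ‖y - z‖) (𝓝[Z] z) (𝓝 0) := by
      have hc : Continuous fun y => δ ‖y - z‖ := by fun_prop
      have := (hc.tendsto z).mono_left (nhdsWithin_le_nhds (s := Z))
      simpa [h0] using this
    rw [ContinuousWithinAt, tendsto_iff_norm_sub_tendsto_zero]
    refine squeeze_zero' (Eventually.of_forall fun _ => norm_nonneg _) ?_ hlim
    filter_upwards [self_mem_nhdsWithin] with y hy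
    exact hgδ y hy z hz
  have hint : IntegrableOn g Z := hcont.integrableOn_compact hZc
  set A := AffineMap.homothety x t '' Z with hA
  have hAc : IsCompact A := hZc.image (AffineMap.homothety_continuous x t)
  have hAZ : A ⊆ Z := by
    rintro _ ⟨z, hz, rfl⟩
    rw [AffineMap.homothety_eq_lineMap]
    exact hZconv.lineMap_mem hx hz ⟨ht0.le, ht1⟩
  have hAvol : volume.real A = t ^ d * volume.real Z := by
    simp [Measure.real, hA, Measure.addHaar_image_homothety, abs_of_pos ht0, ht0.le]
  have hlow : ∀ y ∈ A, g x - δ (t * R) ≤ g y := by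
    rintro _ ⟨z, hz, rfl⟩
    have h1 := hgδ x hx _ (hAZ ⟨z, hz, rfl⟩)
    have h2 : ‖x - AffineMap.homothety x t z‖ ≤ t * R := by
      rw [← dist_eq_norm, dist_comm, dist_homothety_center, dist_eq_norm, Real.norm_eq_abs,
        abs_of_pos ht0]
      exact mul_le_mul_of_nonneg_left (hR _ hx _ hz) ht0.le
    have h3 := hmono (norm_nonneg _) ((norm_nonneg _).trans h2) h2
    linarith [le_abs_self (g x - g (AffineMap.homothety x t z))]
  have hI : (g x - δ (t * R)) * volume.real A ≤ ∫ z in Z, g z := by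
    refine (setIntegral_ge_of_const_le_real hAc.measurableSet hAc.measure_lt_top.ne hlow
      (hint.mono_set hAZ)).trans ?_
    refine setIntegral_mono_set hint ?_ hAZ.eventuallyLE
    exact (ae_restrict_iff' hZc.measurableSet).2 (Eventually.of_forall hg)
  have hpos : 0 < volume.real Z * t ^ d := by positivity
  rw [← sub_le_iff_le_add', le_div_iff₀ hpos]
  rwa [hAvol, mul_comm (t ^ d)] at hI

open MeasureTheory Filter Topology in
/-- For a compact convex set `Z ⊆ ℝ^d` with nonempty interior and a
continuous class-`K∞` modulus `δ`, there is a class-`K∞` function `δ₂` such that every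
nonnegative function `g` on `Z` with modulus of continuity `δ` satisfies
`g(z̄) ≤ δ₂(∫_Z g)` for all `z̄ ∈ Z` (Lebesgue measure). -/
theorem pointwise_bounded_by_integral (d : ℕ) (Z : Set (EuclideanSpace ℝ (Fin d)))
    (hZc : IsCompact Z) (hZconv : Convex ℝ Z) (hZint : (interior Z).Nonempty)
    (δ : ℝ → ℝ) (hδ : IsKInf δ) (hδcont : Continuous δ) :
    ∃ δ₂ : ℝ → ℝ, IsKInf δ₂ ∧
      ∀ g : EuclideanSpace ℝ (Fin d) → ℝ,
        (∀ z ∈ Z, 0 ≤ g z) →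
        (∀ z ∈ Z, ∀ y ∈ Z, |g z - g y| ≤ δ ‖z - y‖) →
        ∀ zbar ∈ Z, g zbar ≤ δ₂ (∫ z in Z, g z) := by
  obtain ⟨hstrict, h0, hnonneg, -⟩ := hδ
  have hV : 0 < volume.real Z :=
    ENNReal.toReal_pos (Measure.measure_pos_of_nonempty_interior _ hZint).ne'
      hZc.measure_lt_top.ne
  set V := volume.real Z
  set R := Metric.diam Z
  have hR0 : 0 ≤ R := Metric.diam_nonneg
  have hR : ∀ z ∈ Z, ∀ y ∈ Z, ‖z - y‖ ≤ R := fun z hz y hy => by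
    rw [← dist_eq_norm]
    exact Metric.dist_le_diam_of_mem hZc.isBounded hz hy
  let s : ℝ → ℝ := fun I => I ^ ((d + 1 : ℝ)⁻¹)
  have hd : (0 : ℝ) < (d + 1 : ℝ)⁻¹ := by positivity
  have hs0 : ∀ I, 0 ≤ I → 0 ≤ s I := fun I hI => Real.rpow_nonneg hI _
  have hspow : ∀ I, 0 ≤ I → s I ^ (d + 1) = I := fun I hI => by
    have := Real.rpow_inv_natCast_pow hI (Nat.succ_ne_zero d)
    simpa [s] using this
  have hs_zero : s 0 = 0 := Real.zero_rpow hd.ne'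
  have hbase : ∀ I, 0 ≤ I → I / V ≤ δ (s I * R) + (s I + I) / V := fun I hI => by
    have h1 := hnonneg _ (mul_nonneg (hs0 I hI) hR0)
    have h2 : I / V ≤ (s I + I) / V := by
      gcongr
      linarith [hs0 I hI]
    linarith
  refine ⟨fun I => δ (s I * R) + (s I + I) / V, ⟨?_, ?_, ?_, ?_⟩, ?_⟩
  · intro a ha b hb hab
    rw [Set.mem_Ici] at ha hb
    have hsab : s a ≤ s b := Real.rpow_le_rpow ha hab.le hd.le
    have h1 : δ (s a * R) ≤ δ (s b * R) :=
      hstrict.monotoneOn (mul_nonneg (hs0 a ha) hR0) (mul_nonneg (hs0 b hb) hR0)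
        (mul_le_mul_of_nonneg_right hsab hR0)
    have h2 : (s a + a) / V < (s b + b) / V := div_lt_div_of_pos_right (by linarith) hV
    exact add_lt_add_of_le_of_lt h1 h2
  · simp [hs_zero, h0]
  · exact fun I hI => (div_nonneg hI hV.le).trans (hbase I hI)
  · refine tendsto_atTop_mono' _ ?_ (tendsto_id.atTop_div_const hV)
    filter_upwards [eventually_ge_atTop 0] with I hI using hbase I hI
  · intro g hg hgδ x hx
    have key : ∀ t : ℝ, 0 < t → t ≤ 1 →
        g x ≤ δ (t * R) + (∫ z in Z, g z) / (V * t ^ d) := fun t ht0 ht1 =>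
      le_modulus_add_integral_div hZc hZconv hV hstrict.monotoneOn h0 hδcont hR hg hgδ hx ht0 ht1
    have hI : 0 ≤ ∫ z in Z, g z := setIntegral_nonneg hZc.measurableSet hg
    generalize (∫ z in Z, g z) = I at key hI
    rcases hI.eq_or_lt with rfl | hIpos
    · have hlim : Tendsto (fun t => δ (t * R)) (𝓝[>] 0) (𝓝 0) := by
        have hc : Continuous fun t => δ (t * R) := by fun_prop
        have := (hc.tendsto 0).mono_left (nhdsWithin_le_nhds (s := Set.Ioi 0))
        simpa [h0] using this
      have : g x ≤ 0 := by
        refine ge_of_tendsto hlim ?_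
        filter_upwards [Ioc_mem_nhdsGT zero_lt_one] with t ht
        simpa using key t ht.1 ht.2
      simpa [hs_zero, h0] using this
    · have hspos : 0 < s I := Real.rpow_pos_of_pos hIpos _
      rcases le_total (s I) 1 with h1 | h1
      · have h2 := key (s I) hspos h1
        have h3 : I / (V * s I ^ d) = s I / V := by
          rw [div_eq_div_iff (by positivity) hV.ne']
          nth_rewrite 1 [← hspow I hI]
          ring
        have h4 : s I / V ≤ (s I + I) / V := by gcongr; linarith
        dsimp only
        linarith
      · have h2 := key 1 one_pos le_rfl
        have h3 : δ (1 * R) ≤ δ (s I * R) :=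
          hstrict.monotoneOn (by simpa using hR0) (mul_nonneg hspos.le hR0)
            (mul_le_mul_of_nonneg_right h1 hR0)
        have h4 : I / V ≤ (s I + I) / V := by gcongr; linarith
        simp only [one_pow, mul_one] at h2
        dsimp only
        linarith
end
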